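/- arXiv:2602.10374 — 4 statements merged into one kernel-verified Lean document; each statement's English description precedes it below -/
import Mathlib

section
/- Suppose the full-space MN problem is feasible. Then the subspace MN problem is feasible, each problem has exactly one minimizer, and if (α̂*, Ĥ*) is the minimizer of the subspace MN problem, then (Q α̂*, Q Ĥ* Qᵀ) is the minimizer of the full-space MN problem. -/
open Matrix

/-- Squared Frobenius norm of a real matrix. -/
noncomputable def frobSq {a b : ℕ} (A : Matrix (Fin a) (Fin b) ℝ) : ℝ :=
  ∑ i, ∑ j, (A i j) ^ 2

/-- Squared Euclidean norm of a real vector. -/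
noncomputable def vecNormSq {a : ℕ} (v : Fin a → ℝ) : ℝ :=
  ∑ i, (v i) ^ 2

/-- `v` lies in the orthogonal complement of the column space of `Q`. -/
def inColPerp {n d : ℕ} (Q : Matrix (Fin n) (Fin d) ℝ) (v : Fin n → ℝ) : Prop :=
  ∀ u : Fin d → ℝ, Q.mulVec u ⬝ᵥ v = 0

/-- Feasibility for the quadratic interpolation constraints: `p = (α, H)` with `H`
symmetric and `(dᵢ)ᵀ α + ½ (dᵢ)ᵀ H dᵢ = rhs i` for all `i`. -/
def QFeas {k m : ℕ} (dd : Fin m → Fin k → ℝ) (rhs : Fin m → ℝ)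
    (p : (Fin k → ℝ) × Matrix (Fin k) (Fin k) ℝ) : Prop :=
  p.2.IsSymm ∧ ∀ i, dd i ⬝ᵥ p.1 + (1 / 2) * (dd i ⬝ᵥ p.2.mulVec (dd i)) = rhs i

/-- Objective of the minimum norm (MN) problem. -/
noncomputable def MNObj {k : ℕ} (p : (Fin k → ℝ) × Matrix (Fin k) (Fin k) ℝ) : ℝ :=
  (1 / 2) * vecNormSq p.1 + (1 / 2) * frobSq p.2

/-- `p` is a minimizer of the MN problem. -/
def MNMin {k m : ℕ} (dd : Fin m → Fin k → ℝ) (rhs : Fin m → ℝ)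
    (p : (Fin k → ℝ) × Matrix (Fin k) (Fin k) ℝ) : Prop :=
  QFeas dd rhs p ∧ ∀ q, QFeas dd rhs q → MNObj p ≤ MNObj q

/-- Objective of the minimum Frobenius norm (MFN) problem. -/
noncomputable def MFNObj {k : ℕ} (p : (Fin k → ℝ) × Matrix (Fin k) (Fin k) ℝ) : ℝ :=
  (1 / 2) * frobSq p.2

/-- `p` is a minimizer of the MFN problem. -/
def MFNMin {k m : ℕ} (dd : Fin m → Fin k → ℝ) (rhs : Fin m → ℝ)
    (p : (Fin k → ℝ) × Matrix (Fin k) (Fin k) ℝ) : Prop :=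
  QFeas dd rhs p ∧ ∀ q, QFeas dd rhs q → MFNObj p ≤ MFNObj q

/-- Objective of the least Frobenius norm updating (LFU) problem. -/
noncomputable def LFUObj {k : ℕ} (Hbar : Matrix (Fin k) (Fin k) ℝ)
    (p : (Fin k → ℝ) × Matrix (Fin k) (Fin k) ℝ) : ℝ :=
  (1 / 2) * frobSq (p.2 - Hbar)

/-- `p` is a minimizer of the LFU problem with reference matrix `Hbar`. -/
def LFUMin {k m : ℕ} (dd : Fin m → Fin k → ℝ) (rhs : Fin m → ℝ)
    (Hbar : Matrix (Fin k) (Fin k) ℝ)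
    (p : (Fin k → ℝ) × Matrix (Fin k) (Fin k) ℝ) : Prop :=
  QFeas dd rhs p ∧ ∀ q, QFeas dd rhs q → LFUObj Hbar p ≤ LFUObj Hbar q

/-- `X` is a Moore–Penrose pseudoinverse of `A`. -/
def IsMPInv {a b : ℕ} (A : Matrix (Fin a) (Fin b) ℝ) (X : Matrix (Fin b) (Fin a) ℝ) : Prop :=
  A * X * A = A ∧ X * A * X = X ∧ (A * X)ᵀ = A * X ∧ (X * A)ᵀ = X * A

/-- The vector `δ_g(y⁰; W)` with `i`-th entry `g(y⁰ + wⁱ) − g(y⁰)`,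
where `wⁱ` is the `i`-th column of `W`. -/
noncomputable def deltaVec {k p : ℕ} (g : (Fin k → ℝ) → ℝ) (y0 : Fin k → ℝ)
    (W : Matrix (Fin k) (Fin p) ℝ) : Fin p → ℝ :=
  fun i => g (y0 + fun j => W j i) - g y0

lemma vecNormSq_eq_dotProduct {a : ℕ} (v : Fin a → ℝ) : vecNormSq v = v ⬝ᵥ v := by
  simp [vecNormSq, dotProduct, sq]

lemma vecNormSq_nonneg {a : ℕ} (v : Fin a → ℝ) : 0 ≤ vecNormSq v :=
  Finset.sum_nonneg fun _ _ => sq_nonneg _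

lemma frobSq_nonneg {a b : ℕ} (A : Matrix (Fin a) (Fin b) ℝ) : 0 ≤ frobSq A :=
  Finset.sum_nonneg fun _ _ => Finset.sum_nonneg fun _ _ => sq_nonneg _

lemma sq_le_vecNormSq {a : ℕ} (v : Fin a → ℝ) (i : Fin a) : (v i) ^ 2 ≤ vecNormSq v :=
  Finset.single_le_sum (f := fun i => (v i) ^ 2) (fun _ _ => sq_nonneg _) (Finset.mem_univ i)

lemma sq_le_frobSq {a b : ℕ} (A : Matrix (Fin a) (Fin b) ℝ) (i : Fin a) (j : Fin b) :
    (A i j) ^ 2 ≤ frobSq A :=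
  (sq_le_vecNormSq (A i) j).trans <|
    Finset.single_le_sum (f := fun i => vecNormSq (A i)) (fun _ _ => vecNormSq_nonneg _)
      (Finset.mem_univ i)

lemma frobSq_transpose {a b : ℕ} (A : Matrix (Fin a) (Fin b) ℝ) : frobSq Aᵀ = frobSq A :=
  Finset.sum_comm

lemma frobSq_eq_sum_col {a b : ℕ} (A : Matrix (Fin a) (Fin b) ℝ) :
    frobSq A = ∑ j, vecNormSq (fun i => A i j) :=
  Finset.sum_comm

lemma eq_zero_of_MNObj_nonpos {k : ℕ} {p : (Fin k → ℝ) × Matrix (Fin k) (Fin k) ℝ}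
    (h : MNObj p ≤ 0) : p = 0 := by
  have hv := vecNormSq_nonneg p.1
  have hf := frobSq_nonneg p.2
  unfold MNObj at h
  ext i j
  · have := sq_le_vecNormSq p.1 i
    exact pow_eq_zero_iff two_ne_zero |>.mp (le_antisymm (by linarith) (sq_nonneg _))
  · have := sq_le_frobSq p.2 i j
    exact pow_eq_zero_iff two_ne_zero |>.mp (le_antisymm (by linarith) (sq_nonneg _))

lemma vecNormSq_midpoint {a : ℕ} (u v : Fin a → ℝ) :
    vecNormSq ((1 / 2 : ℝ) • (u + v)) =
      (1 / 2) * vecNormSq u + (1 / 2) * vecNormSq v - (1 / 4) * vecNormSq (u - v) := by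
  simp only [vecNormSq, Pi.add_apply, Pi.sub_apply, Pi.smul_apply, smul_eq_mul, Finset.mul_sum,
    ← Finset.sum_add_distrib, ← Finset.sum_sub_distrib]
  exact Finset.sum_congr rfl fun _ _ => by ring

lemma frobSq_midpoint {a b : ℕ} (A B : Matrix (Fin a) (Fin b) ℝ) :
    frobSq ((1 / 2 : ℝ) • (A + B)) =
      (1 / 2) * frobSq A + (1 / 2) * frobSq B - (1 / 4) * frobSq (A - B) := by
  simp only [frobSq, Finset.mul_sum (Finset.univ : Finset (Fin a)), ← Finset.sum_add_distrib,
    ← Finset.sum_sub_distrib (s := (Finset.univ : Finset (Fin a)))]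
  exact Finset.sum_congr rfl fun i _ => vecNormSq_midpoint (A i) (B i)

lemma MNObj_midpoint {k : ℕ} (p q : (Fin k → ℝ) × Matrix (Fin k) (Fin k) ℝ) :
    MNObj ((1 / 2 : ℝ) • (p + q)) =
      (1 / 2) * MNObj p + (1 / 2) * MNObj q - (1 / 4) * MNObj (p - q) := by
  simp only [MNObj, Prod.fst_add, Prod.snd_add, Prod.smul_fst, Prod.smul_snd, Prod.fst_sub,
    Prod.snd_sub, vecNormSq_midpoint, frobSq_midpoint]
  ring

lemma QFeas.midpoint {k m : ℕ} {dd : Fin m → Fin k → ℝ} {rhs : Fin m → ℝ}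
    {p q : (Fin k → ℝ) × Matrix (Fin k) (Fin k) ℝ} (hp : QFeas dd rhs p) (hq : QFeas dd rhs q) :
    QFeas dd rhs ((1 / 2 : ℝ) • (p + q)) := by
  refine ⟨(hp.1.add hq.1).smul _, fun i => ?_⟩
  have h₁ := hp.2 i
  have h₂ := hq.2 i
  simp only [Prod.fst_add, Prod.snd_add, Prod.smul_fst, Prod.smul_snd, dotProduct_smul,
    dotProduct_add, smul_mulVec, add_mulVec, smul_eq_mul]
  linarith

lemma MNMin.unique {k m : ℕ} {dd : Fin m → Fin k → ℝ} {rhs : Fin m → ℝ}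
    {p q : (Fin k → ℝ) × Matrix (Fin k) (Fin k) ℝ} (hp : MNMin dd rhs p) (hq : MNMin dd rhs q) :
    p = q := by
  have h₁ := hp.2 _ (hp.1.midpoint hq.1)
  have h₂ := hq.2 _ hp.1
  rw [MNObj_midpoint] at h₁
  exact sub_eq_zero.mp (eq_zero_of_MNObj_nonpos (by linarith [hp.2 _ hq.1]))

lemma continuous_MNObj {k : ℕ} :
    Continuous (MNObj : (Fin k → ℝ) × Matrix (Fin k) (Fin k) ℝ → ℝ) := by
  unfold MNObj vecNormSq frobSq
  fun_prop

lemma isClosed_setOf_QFeas {k m : ℕ} (dd : Fin m → Fin k → ℝ) (rhs : Fin m → ℝ) :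
    IsClosed {p | QFeas dd rhs p} := by
  simp only [QFeas, Matrix.IsSymm, Set.ofPred_and, Set.ofPred_forall]
  refine (isClosed_eq (by fun_prop) (by fun_prop)).inter
    (isClosed_iInter fun i => isClosed_eq ?_ continuous_const)
  simp only [dotProduct, mulVec]
  fun_prop

lemma isCompact_setOf_MNObj_le {k : ℕ} (c : ℝ) :
    IsCompact {p : (Fin k → ℝ) × Matrix (Fin k) (Fin k) ℝ | MNObj p ≤ c} := by
  have hbox : IsCompact
      ((Set.univ.pi fun _ => Set.Icc (-√(2 * c)) √(2 * c)) ×ˢ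
        (Set.univ.pi fun _ => Set.univ.pi fun _ => Set.Icc (-√(2 * c)) √(2 * c)) :
        Set ((Fin k → ℝ) × Matrix (Fin k) (Fin k) ℝ)) :=
    (isCompact_univ_pi fun _ => isCompact_Icc).prod
      (isCompact_univ_pi fun _ => isCompact_univ_pi fun _ => isCompact_Icc)
  refine hbox.of_isClosed_subset (isClosed_le continuous_MNObj continuous_const) fun p hp => ?_
  have hv := vecNormSq_nonneg p.1
  have hf := frobSq_nonneg p.2
  replace hp : 1 / 2 * vecNormSq p.1 + 1 / 2 * frobSq p.2 ≤ c := hp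
  refine ⟨fun i _ => ?_, fun i _ j _ => ?_⟩
  · exact abs_le.mp (Real.abs_le_sqrt (by linarith [sq_le_vecNormSq p.1 i]))
  · exact abs_le.mp (Real.abs_le_sqrt (by linarith [sq_le_frobSq p.2 i j]))

lemma exists_MNMin {k m : ℕ} {dd : Fin m → Fin k → ℝ} {rhs : Fin m → ℝ}
    (h : ∃ p, QFeas dd rhs p) : ∃ p, MNMin dd rhs p := by
  obtain ⟨p₀, hp₀⟩ := h
  obtain ⟨p, ⟨hp, hpc⟩, hmin⟩ :=
    ((isCompact_setOf_MNObj_le (MNObj p₀)).inter_left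
      (isClosed_setOf_QFeas dd rhs)).exists_isMinOn ⟨p₀, hp₀, le_refl (MNObj p₀)⟩
      continuous_MNObj.continuousOn
  refine ⟨p, hp, fun q hq => ?_⟩
  rcases le_total (MNObj q) (MNObj p₀) with hle | hle
  · exact hmin ⟨hq, hle⟩
  · exact le_trans hpc hle

lemma existsUnique_MNMin {k m : ℕ} {dd : Fin m → Fin k → ℝ} {rhs : Fin m → ℝ}
    (h : ∃ p, QFeas dd rhs p) : ∃! p, MNMin dd rhs p := by
  obtain ⟨p, hp⟩ := exists_MNMin h
  exact ⟨p, hp, fun q hq => hq.unique hp⟩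

section Isometry

variable {n d : ℕ} {Q : Matrix (Fin n) (Fin d) ℝ}

lemma vecNormSq_mulVec (hQ : Qᵀ * Q = 1) (u : Fin d → ℝ) :
    vecNormSq (Q *ᵥ u) = vecNormSq u := by
  rw [vecNormSq_eq_dotProduct, vecNormSq_eq_dotProduct, dotProduct_mulVec, ← mulVec_transpose,
    mulVec_mulVec, hQ, one_mulVec]

lemma vecNormSq_transpose_mulVec_le (hQ : Qᵀ * Q = 1) (v : Fin n → ℝ) :
    vecNormSq (Qᵀ *ᵥ v) ≤ vecNormSq v := by
  have h₁ := vecNormSq_nonneg (v - Q *ᵥ (Qᵀ *ᵥ v))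
  have h₂ := vecNormSq_mulVec hQ (Qᵀ *ᵥ v)
  have h₃ : v ⬝ᵥ Q *ᵥ (Qᵀ *ᵥ v) = vecNormSq (Qᵀ *ᵥ v) := by
    rw [dotProduct_mulVec, ← mulVec_transpose, vecNormSq_eq_dotProduct]
  rw [vecNormSq_eq_dotProduct (_ - _), sub_dotProduct, dotProduct_sub, dotProduct_sub,
    dotProduct_comm (Q *ᵥ _) v, h₃, ← vecNormSq_eq_dotProduct, ← vecNormSq_eq_dotProduct, h₂] at h₁
  linarith

lemma frobSq_mul (hQ : Qᵀ * Q = 1) {b : ℕ} (A : Matrix (Fin d) (Fin b) ℝ) :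
    frobSq (Q * A) = frobSq A := by
  rw [frobSq_eq_sum_col, frobSq_eq_sum_col]
  exact Finset.sum_congr rfl fun j _ => vecNormSq_mulVec hQ fun i => A i j

lemma frobSq_transpose_mul_le (hQ : Qᵀ * Q = 1) {b : ℕ} (A : Matrix (Fin n) (Fin b) ℝ) :
    frobSq (Qᵀ * A) ≤ frobSq A := by
  rw [frobSq_eq_sum_col, frobSq_eq_sum_col]
  exact Finset.sum_le_sum fun j _ => vecNormSq_transpose_mulVec_le hQ fun i => A i j

lemma MNObj_lift (hQ : Qᵀ * Q = 1) (p : (Fin d → ℝ) × Matrix (Fin d) (Fin d) ℝ) :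
    MNObj (Q *ᵥ p.1, Q * p.2 * Qᵀ) = MNObj p := by
  simp only [MNObj]
  rw [vecNormSq_mulVec hQ, Matrix.mul_assoc, frobSq_mul hQ, ← frobSq_transpose, transpose_mul,
    transpose_transpose, frobSq_mul hQ, frobSq_transpose]

lemma MNObj_restrict_le (hQ : Qᵀ * Q = 1) (q : (Fin n → ℝ) × Matrix (Fin n) (Fin n) ℝ) :
    MNObj (Qᵀ *ᵥ q.1, Qᵀ * q.2 * Q) ≤ MNObj q := by
  have h₁ := vecNormSq_transpose_mulVec_le hQ q.1
  have h₂ : frobSq (Qᵀ * q.2 * Q) ≤ frobSq q.2 := by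
    rw [Matrix.mul_assoc]
    refine (frobSq_transpose_mul_le hQ _).trans ?_
    rw [← frobSq_transpose, transpose_mul, ← frobSq_transpose q.2]
    exact frobSq_transpose_mul_le hQ _
  simp only [MNObj]
  linarith

lemma QFeas.restrict {m : ℕ} {dh : Fin m → Fin d → ℝ} {rhs : Fin m → ℝ}
    {q : (Fin n → ℝ) × Matrix (Fin n) (Fin n) ℝ}
    (hq : QFeas (fun i => Q *ᵥ dh i) rhs q) :
    QFeas dh rhs (Qᵀ *ᵥ q.1, Qᵀ * q.2 * Q) := by
  refine ⟨?_, fun i => ?_⟩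
  · simp only [Matrix.IsSymm, transpose_mul, transpose_transpose, hq.1.eq, Matrix.mul_assoc]
  · rw [← hq.2 i]
    simp only [dotProduct_mulVec, vecMul_transpose, ← vecMul_vecMul]

lemma QFeas.lift (hQ : Qᵀ * Q = 1) {m : ℕ} {dh : Fin m → Fin d → ℝ} {rhs : Fin m → ℝ}
    {p : (Fin d → ℝ) × Matrix (Fin d) (Fin d) ℝ} (hp : QFeas dh rhs p) :
    QFeas (fun i => Q *ᵥ dh i) rhs (Q *ᵥ p.1, Q * p.2 * Qᵀ) := by
  have h : ∀ u, (Q *ᵥ u) ᵥ* Q = u := fun u => by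
    rw [← mulVec_transpose, mulVec_mulVec, hQ, one_mulVec]
  refine ⟨?_, fun i => ?_⟩
  · simp only [Matrix.IsSymm, transpose_mul, transpose_transpose, hp.1.eq, Matrix.mul_assoc]
  · rw [← hp.2 i]
    simp only [← mulVec_mulVec, dotProduct_mulVec _ Q, h]
    rw [mulVec_transpose, h]

lemma MNMin.lift (hQ : Qᵀ * Q = 1) {m : ℕ} {dh : Fin m → Fin d → ℝ} {rhs : Fin m → ℝ}
    {p : (Fin d → ℝ) × Matrix (Fin d) (Fin d) ℝ} (hp : MNMin dh rhs p) :
    MNMin (fun i => Q *ᵥ dh i) rhs (Q *ᵥ p.1, Q * p.2 * Qᵀ) :=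
  ⟨hp.1.lift hQ, fun q hq =>
    (MNObj_lift hQ p).trans_le ((hp.2 _ hq.restrict).trans (MNObj_restrict_le hQ q))⟩

end Isometry

/-- If the full-space MN problem is feasible, then the subspace MN
problem is feasible, each problem has exactly one minimizer, and the minimizer
`(α̂*, Ĥ*)` of the subspace problem yields the minimizer `(Q α̂*, Q Ĥ* Qᵀ)` of the
full-space problem. -/
theorem stmt_0 {n d m : ℕ} (hn : 0 < n) (hd : 0 < d) (hm : 0 < m) (hdn : d < n)
    (Q : Matrix (Fin n) (Fin d) ℝ) (hQ : Qᵀ * Q = 1)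
    (f : (Fin n → ℝ) → ℝ) (x0 : Fin n → ℝ) (dh : Fin m → Fin d → ℝ)
    (fh : (Fin d → ℝ) → ℝ) (hfh : ∀ xh, fh xh = f (x0 + Q.mulVec xh))
    (hfeas : ∃ p, QFeas (fun i => Q.mulVec (dh i))
      (fun i => f (x0 + Q.mulVec (dh i)) - f x0) p) :
    (∃ p, QFeas dh (fun i => fh (dh i) - fh 0) p) ∧
    (∃! p, MNMin (fun i => Q.mulVec (dh i))
      (fun i => f (x0 + Q.mulVec (dh i)) - f x0) p) ∧
    (∃! p, MNMin dh (fun i => fh (dh i) - fh 0) p) ∧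
    (∀ p, MNMin dh (fun i => fh (dh i) - fh 0) p →
      MNMin (fun i => Q.mulVec (dh i)) (fun i => f (x0 + Q.mulVec (dh i)) - f x0)
        (Q.mulVec p.1, Q * p.2 * Qᵀ)) := by
  have h₀ : fh 0 = f x0 := by simp [hfh]
  simp only [hfh (dh _), h₀]
  have hsub := hfeas.imp' _ fun _ hq => hq.restrict
  exact ⟨hsub, existsUnique_MNMin hfeas, existsUnique_MNMin hsub, fun _ hp => hp.lift hQ⟩
end

section
/- Suppose the full-space MFN problem is feasible. Let (α, H) be a minimizer of the full-space MFN problem and (α̂, Ĥ) a minimizer of the subspace MFN problem such that α − Q α̂ ∈ col(Q)⊥. Then for every x̂ ∈ ℝᵈ, the associated models satisfy m(x⁰ + Q x̂) = m̂(x̂). -/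
open Matrix

theorem frobSq_eq_trace {a b : ℕ} (A : Matrix (Fin a) (Fin b) ℝ) :
    frobSq A = (Aᵀ * A).trace := by
  simp only [frobSq, Matrix.trace, Matrix.diag, Matrix.mul_apply, Matrix.transpose_apply]
  rw [Finset.sum_comm]
  simp only [pow_two]

theorem frobSq_add_smul {a b : ℕ} (A B : Matrix (Fin a) (Fin b) ℝ) (t : ℝ) :
    frobSq (A + t • B) = frobSq A + 2 * t * (Aᵀ * B).trace + t ^ 2 * frobSq B := by
  have h : (Bᵀ * A).trace = (Aᵀ * B).trace := by
    rw [← Matrix.trace_transpose, Matrix.transpose_mul, Matrix.transpose_transpose]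
  simp only [frobSq_eq_trace, Matrix.transpose_add, Matrix.transpose_smul, Matrix.add_mul,
    Matrix.mul_add, Matrix.trace_add, Matrix.smul_mul, Matrix.mul_smul, Matrix.trace_smul,
    smul_eq_mul, h]
  ring

theorem eq_zero_of_frobSq_nonpos {a b : ℕ} {A : Matrix (Fin a) (Fin b) ℝ}
    (h : frobSq A ≤ 0) : A = 0 := by
  have hrow : ∀ i, 0 ≤ ∑ j, A i j ^ 2 := fun i => Finset.sum_nonneg fun j _ => sq_nonneg _
  have h0 : ∑ i, ∑ j, A i j ^ 2 = 0 := le_antisymm h (Finset.sum_nonneg fun i _ => hrow i)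
  ext i j
  have hi := (Finset.sum_eq_zero_iff_of_nonneg fun i _ => hrow i).mp h0 i (Finset.mem_univ i)
  have hij := (Finset.sum_eq_zero_iff_of_nonneg fun j _ => sq_nonneg (A i j)).mp hi j
    (Finset.mem_univ j)
  exact (pow_eq_zero_iff two_ne_zero).mp hij

theorem mulVec_dotProduct_comm {n d : ℕ} (Q : Matrix (Fin n) (Fin d) ℝ) (u : Fin d → ℝ)
    (v : Fin n → ℝ) : Q *ᵥ u ⬝ᵥ v = u ⬝ᵥ Qᵀ *ᵥ v := by
  rw [Matrix.dotProduct_mulVec, Matrix.vecMul_transpose]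

theorem mulVec_quadForm {n d : ℕ} (Q : Matrix (Fin n) (Fin d) ℝ)
    (H : Matrix (Fin n) (Fin n) ℝ) (u : Fin d → ℝ) :
    Q *ᵥ u ⬝ᵥ H *ᵥ (Q *ᵥ u) = u ⬝ᵥ (Qᵀ * H * Q) *ᵥ u := by
  rw [mulVec_dotProduct_comm, Matrix.mulVec_mulVec, Matrix.mulVec_mulVec, Matrix.mul_assoc]

theorem transpose_mul_conj_mul {n d : ℕ} {Q : Matrix (Fin n) (Fin d) ℝ} (hQ : Qᵀ * Q = 1)
    (E : Matrix (Fin d) (Fin d) ℝ) : Qᵀ * (Q * E * Qᵀ) * Q = E := by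
  have h : Qᵀ * (Q * E * Qᵀ) * Q = (Qᵀ * Q) * E * (Qᵀ * Q) := by
    simp only [Matrix.mul_assoc]
  rw [h, hQ, Matrix.one_mul, Matrix.mul_one]

theorem trace_transpose_mul_conj {n d : ℕ} (Q : Matrix (Fin n) (Fin d) ℝ)
    (H : Matrix (Fin n) (Fin n) ℝ) (E : Matrix (Fin d) (Fin d) ℝ) :
    (Hᵀ * (Q * E * Qᵀ)).trace = ((Qᵀ * H * Q)ᵀ * E).trace := by
  rw [← Matrix.mul_assoc, Matrix.trace_mul_comm]
  simp only [Matrix.transpose_mul, Matrix.transpose_transpose, Matrix.mul_assoc]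

theorem frobSq_conj {n d : ℕ} {Q : Matrix (Fin n) (Fin d) ℝ} (hQ : Qᵀ * Q = 1)
    (E : Matrix (Fin d) (Fin d) ℝ) : frobSq (Q * E * Qᵀ) = frobSq E := by
  rw [frobSq_eq_trace, trace_transpose_mul_conj, transpose_mul_conj_mul hQ, frobSq_eq_trace]

/-- Along a symmetric direction that is invisible to the interpolation conditions, moving
away from a minimizer does not decrease the Frobenius norm. -/
theorem MFNMin.smul_direction_nonneg {k m : ℕ} {dd : Fin m → Fin k → ℝ} {rhs : Fin m → ℝ}
    {a : Fin k → ℝ} {H : Matrix (Fin k) (Fin k) ℝ} (hmin : MFNMin dd rhs (a, H))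
    {P : Matrix (Fin k) (Fin k) ℝ} (hP : P.IsSymm) (hzero : ∀ i, dd i ⬝ᵥ P *ᵥ dd i = 0)
    (t : ℝ) : 0 ≤ 2 * t * (Hᵀ * P).trace + t ^ 2 * frobSq P := by
  have hfeas : QFeas dd rhs (a, H + t • P) := by
    refine ⟨hmin.1.1.add (hP.smul t), fun i => ?_⟩
    have hi := hmin.1.2 i
    simpa [Matrix.add_mulVec, Matrix.smul_mulVec, dotProduct_add, hzero i] using hi
  have h := hmin.2 _ hfeas
  simp only [MFNObj, frobSq_add_smul] at h
  linarith

/-- If the full-space MFN problem is feasible, `(α, H)` is a minimizer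
of the full-space MFN problem, `(α̂, Ĥ)` is a minimizer of the subspace MFN problem,
and `α − Q α̂ ∈ col(Q)⊥`, then `m(x⁰ + Q x̂) = m̂(x̂)` for every `x̂ ∈ ℝᵈ`. -/
theorem stmt_6 {n d m : ℕ} (hn : 0 < n) (hd : 0 < d) (hm : 0 < m) (hdn : d < n)
    (Q : Matrix (Fin n) (Fin d) ℝ) (hQ : Qᵀ * Q = 1)
    (f : (Fin n → ℝ) → ℝ) (x0 : Fin n → ℝ) (dh : Fin m → Fin d → ℝ)
    (fh : (Fin d → ℝ) → ℝ) (hfh : ∀ xh, fh xh = f (x0 + Q.mulVec xh))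
    (hfeas : ∃ p, QFeas (fun i => Q.mulVec (dh i))
      (fun i => f (x0 + Q.mulVec (dh i)) - f x0) p)
    (α : Fin n → ℝ) (H : Matrix (Fin n) (Fin n) ℝ)
    (hmin : MFNMin (fun i => Q.mulVec (dh i))
      (fun i => f (x0 + Q.mulVec (dh i)) - f x0) (α, H))
    (αh : Fin d → ℝ) (Hh : Matrix (Fin d) (Fin d) ℝ)
    (hminh : MFNMin dh (fun i => fh (dh i) - fh 0) (αh, Hh))
    (hrel : inColPerp Q (α - Q.mulVec αh)) :
    ∀ xh : Fin d → ℝ,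
      f x0 + α ⬝ᵥ (x0 + Q.mulVec xh - x0)
        + (1 / 2) * ((x0 + Q.mulVec xh - x0) ⬝ᵥ H.mulVec (x0 + Q.mulVec xh - x0))
      = fh 0 + αh ⬝ᵥ xh + (1 / 2) * (xh ⬝ᵥ Hh.mulVec xh) := by
  have hα : ∀ u : Fin d → ℝ, Q *ᵥ u ⬝ᵥ α = u ⬝ᵥ αh := by
    intro u
    have h := hrel u
    rw [dotProduct_sub, sub_eq_zero] at h
    rw [h, mulVec_dotProduct_comm, Matrix.mulVec_mulVec, hQ, Matrix.one_mulVec]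
  have hf0 : fh 0 = f x0 := by rw [hfh, Matrix.mulVec_zero, add_zero]
  set E : Matrix (Fin d) (Fin d) ℝ := Hh - Qᵀ * H * Q with hE
  have hHs : Hᵀ = H := hmin.1.1
  have hEs : E.IsSymm := by
    refine Matrix.IsSymm.sub hminh.1.1 ?_
    simp only [Matrix.IsSymm, Matrix.transpose_mul, Matrix.transpose_transpose, hHs,
      Matrix.mul_assoc]
  have hEzero : ∀ i, dh i ⬝ᵥ E *ᵥ dh i = 0 := by
    intro i
    have h₁ := hmin.1.2 i
    have h₂ := hminh.1.2 i
    simp only [hα, mulVec_quadForm] at h₁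
    simp only [hfh (dh i), hf0] at h₂
    rw [hE, Matrix.sub_mulVec, dotProduct_sub]
    linarith
  have hPs : (Q * E * Qᵀ).IsSymm := by
    simp only [Matrix.IsSymm, Matrix.transpose_mul, Matrix.transpose_transpose, hEs.eq,
      Matrix.mul_assoc]
  have hfull := hmin.smul_direction_nonneg hPs
    (fun i => by rw [mulVec_quadForm, transpose_mul_conj_mul hQ, hEzero i]) (1 / 2)
  have hsub := hminh.smul_direction_nonneg hEs hEzero (-1 / 2)
  rw [trace_transpose_mul_conj, frobSq_conj hQ] at hfull
  have hsplit : (Hhᵀ * E).trace = ((Qᵀ * H * Q)ᵀ * E).trace + frobSq E := by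
    rw [frobSq_eq_trace, ← Matrix.trace_add, ← Matrix.add_mul, ← Matrix.transpose_add, hE,
      add_sub_cancel]
  have hE0 : E = 0 := eq_zero_of_frobSq_nonpos (by linarith)
  have hHh : Hh = Qᵀ * H * Q := sub_eq_zero.mp hE0
  intro xh
  rw [add_sub_cancel_left, mulVec_quadForm, ← hHh, dotProduct_comm α, hα, hf0,
    dotProduct_comm xh αh]
end

section
/- Suppose the full-space LFU problem is feasible. Let (α, H) be a minimizer of the full-space LFU problem and (α̂, Ĥ) a minimizer of the subspace LFU problem such that α − Q α̂ ∈ col(Q)⊥. Then for every x̂ ∈ ℝᵈ, the associated models satisfy m(x⁰ + Q x̂) = m̂(x̂). -/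
open Matrix

theorem frobSq_add {a b : ℕ} (A B : Matrix (Fin a) (Fin b) ℝ) :
    frobSq (A + B) = frobSq A + 2 * (Aᵀ * B).trace + frobSq B := by
  have h : (Bᵀ * A).trace = (Aᵀ * B).trace := by
    rw [← Matrix.trace_transpose, Matrix.transpose_mul, Matrix.transpose_transpose]
  simp only [frobSq_eq_trace, Matrix.transpose_add, Matrix.add_mul, Matrix.mul_add,
    Matrix.trace_add, h]
  ring

theorem frobSq_smul {a b : ℕ} (c : ℝ) (A : Matrix (Fin a) (Fin b) ℝ) :
    frobSq (c • A) = c ^ 2 * frobSq A := by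
  simp [frobSq, mul_pow, Finset.mul_sum]

section OrthonormalColumns

variable {n d : ℕ} {Q : Matrix (Fin n) (Fin d) ℝ}

theorem frobSq_add_conj (hQ : Qᵀ * Q = 1) (A : Matrix (Fin n) (Fin n) ℝ)
    (D : Matrix (Fin d) (Fin d) ℝ) :
    frobSq (A + Q * D * Qᵀ) = frobSq A + 2 * ((Qᵀ * A * Q)ᵀ * D).trace + frobSq D := by
  have h1 : (Aᵀ * (Q * D * Qᵀ)).trace = ((Qᵀ * A * Q)ᵀ * D).trace := by
    rw [← Matrix.mul_assoc, Matrix.trace_mul_comm]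
    simp only [Matrix.transpose_mul, Matrix.transpose_transpose, Matrix.mul_assoc]
  have h2 : frobSq (Q * D * Qᵀ) = frobSq D := by
    have h3 : (Q * D * Qᵀ)ᵀ * (Q * D * Qᵀ) = Q * (Dᵀ * D * Qᵀ) := by
      calc (Q * D * Qᵀ)ᵀ * (Q * D * Qᵀ) = Q * Dᵀ * (Qᵀ * Q) * D * Qᵀ := by
            simp only [Matrix.transpose_mul, Matrix.transpose_transpose, Matrix.mul_assoc]
        _ = Q * (Dᵀ * D * Qᵀ) := by
            rw [hQ, Matrix.mul_one]; simp only [Matrix.mul_assoc]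
    rw [frobSq_eq_trace, frobSq_eq_trace, h3, Matrix.trace_mul_comm, Matrix.mul_assoc, hQ,
      Matrix.mul_one]
  rw [frobSq_add, h1, h2]

theorem conj_add_conj (hQ : Qᵀ * Q = 1) (A : Matrix (Fin n) (Fin n) ℝ)
    (D : Matrix (Fin d) (Fin d) ℝ) :
    Qᵀ * (A + Q * D * Qᵀ) * Q = Qᵀ * A * Q + D := by
  have h : Qᵀ * (Q * D * Qᵀ) * Q = (Qᵀ * Q) * D * (Qᵀ * Q) := by
    simp only [Matrix.mul_assoc]
  rw [Matrix.mul_add, Matrix.add_mul, h, hQ, Matrix.one_mul, Matrix.mul_one]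

theorem mulVec_dotProduct_mulVec_mulVec (A : Matrix (Fin n) (Fin n) ℝ) (u : Fin d → ℝ) :
    Q.mulVec u ⬝ᵥ A.mulVec (Q.mulVec u) = u ⬝ᵥ (Qᵀ * A * Q).mulVec u := by
  rw [← Matrix.mulVec_mulVec, ← Matrix.mulVec_mulVec, Matrix.dotProduct_transpose_mulVec,
    dotProduct_comm]

theorem inColPerp.mulVec_dotProduct (hQ : Qᵀ * Q = 1) {α : Fin n → ℝ} {αh : Fin d → ℝ}
    (h : inColPerp Q (α - Q.mulVec αh)) (u : Fin d → ℝ) :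
    Q.mulVec u ⬝ᵥ α = u ⬝ᵥ αh := by
  have h1 := h u
  rw [dotProduct_sub, sub_eq_zero] at h1
  rw [h1, dotProduct_comm, ← Matrix.dotProduct_transpose_mulVec, Matrix.mulVec_mulVec, hQ,
    Matrix.one_mulVec]

end OrthonormalColumns

/-- If the full-space LFU problem is feasible, `(α, H)` is a minimizer
of the full-space LFU problem, `(α̂, Ĥ)` is a minimizer of the subspace LFU problem,
and `α − Q α̂ ∈ col(Q)⊥`, then `m(x⁰ + Q x̂) = m̂(x̂)` for every `x̂ ∈ ℝᵈ`. -/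
theorem stmt_11 {n d m : ℕ} (hn : 0 < n) (hd : 0 < d) (hm : 0 < m) (hdn : d < n)
    (Q : Matrix (Fin n) (Fin d) ℝ) (hQ : Qᵀ * Q = 1)
    (f : (Fin n → ℝ) → ℝ) (x0 : Fin n → ℝ) (dh : Fin m → Fin d → ℝ)
    (fh : (Fin d → ℝ) → ℝ) (hfh : ∀ xh, fh xh = f (x0 + Q.mulVec xh))
    (Hbar : Matrix (Fin n) (Fin n) ℝ) (hHbar : Hbar.IsSymm)
    (hfeas : ∃ p, QFeas (fun i => Q.mulVec (dh i))
      (fun i => f (x0 + Q.mulVec (dh i)) - f x0) p)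
    (α : Fin n → ℝ) (H : Matrix (Fin n) (Fin n) ℝ)
    (hmin : LFUMin (fun i => Q.mulVec (dh i))
      (fun i => f (x0 + Q.mulVec (dh i)) - f x0) Hbar (α, H))
    (αh : Fin d → ℝ) (Hh : Matrix (Fin d) (Fin d) ℝ)
    (hminh : LFUMin dh (fun i => fh (dh i) - fh 0) (Qᵀ * Hbar * Q) (αh, Hh))
    (hrel : inColPerp Q (α - Q.mulVec αh)) :
    ∀ xh : Fin d → ℝ,
      f x0 + α ⬝ᵥ (x0 + Q.mulVec xh - x0)
        + (1 / 2) * ((x0 + Q.mulVec xh - x0) ⬝ᵥ H.mulVec (x0 + Q.mulVec xh - x0))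
      = fh 0 + αh ⬝ᵥ xh + (1 / 2) * (xh ⬝ᵥ Hh.mulVec xh) := by
  intro xh
  have hα := hrel.mulVec_dotProduct hQ
  have hf0 : fh 0 = f x0 := by simp [hfh]
  set K := Qᵀ * H * Q with hK
  have hKs : K.IsSymm := by
    simp only [hK, Matrix.IsSymm, Matrix.transpose_mul, Matrix.transpose_transpose, hmin.1.1.eq,
      Matrix.mul_assoc]
  have hHs : Hh.IsSymm := hminh.1.1
  have hKi (i : Fin m) := hmin.1.2 i
  have hHi (i : Fin m) := hminh.1.2 i
  simp only [hα, mulVec_dotProduct_mulVec_mulVec, ← hK] at hKi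
  simp only [hfh, Matrix.mulVec_zero, add_zero] at hHi
  set E := Hh - K with hE
  have hEs : E.IsSymm := hHs.sub hKs
  have hEi (i : Fin m) : dh i ⬝ᵥ E.mulVec (dh i) = 0 := by
    rw [hE, Matrix.sub_mulVec, dotProduct_sub]
    linarith [hKi i, hHi i]
  set X := K - Qᵀ * Hbar * Q with hX
  have hfull : LFUObj Hbar (α, H) ≤ LFUObj Hbar (α, H + Q * ((1 / 2 : ℝ) • E) * Qᵀ) := by
    refine hmin.2 _ ⟨hmin.1.1.add ?_, fun i => ?_⟩
    · simp only [Matrix.IsSymm, Matrix.transpose_mul, Matrix.transpose_transpose,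
        Matrix.transpose_smul, hEs.eq, Matrix.mul_assoc]
    · simp only [hα, mulVec_dotProduct_mulVec_mulVec, conj_add_conj hQ, ← hK]
      simp only [Matrix.add_mulVec, Matrix.smul_mulVec, dotProduct_add, dotProduct_smul, hEi,
        smul_zero, add_zero]
      exact hKi i
  have hsub : LFUObj (Qᵀ * Hbar * Q) (αh, Hh) ≤
      LFUObj (Qᵀ * Hbar * Q) (αh, K + (1 / 2 : ℝ) • E) := by
    refine hminh.2 _ ⟨hKs.add (hEs.smul _), fun i => ?_⟩
    simp only [Matrix.add_mulVec, Matrix.smul_mulVec, dotProduct_add, dotProduct_smul, hEi,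
      smul_zero, add_zero, hfh, Matrix.mulVec_zero]
    exact hKi i
  have e1 : H + Q * ((1 / 2 : ℝ) • E) * Qᵀ - Hbar
      = (H - Hbar) + Q * ((1 / 2 : ℝ) • E) * Qᵀ := by abel
  have e2 : Qᵀ * (H - Hbar) * Q = X := by rw [Matrix.mul_sub, Matrix.sub_mul]
  have e3 : Hh - Qᵀ * Hbar * Q = X + E := by rw [hX, hE]; abel
  have e4 : K + (1 / 2 : ℝ) • E - Qᵀ * Hbar * Q = X + (1 / 2 : ℝ) • E := by rw [hX]; abel
  simp only [LFUObj, e1, frobSq_add_conj hQ, e2] at hfull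
  simp only [LFUObj, e3, e4, frobSq_add] at hsub
  simp only [frobSq_smul, Matrix.mul_smul, Matrix.trace_smul, smul_eq_mul] at hfull hsub
  have hE0 : E = 0 := eq_zero_of_frobSq_nonpos (by linarith)
  have hHK : Hh = K := sub_eq_zero.mp hE0
  rw [add_sub_cancel_left, dotProduct_comm α, hα, mulVec_dotProduct_mulVec_mulVec, ← hK, hHK, hf0,
    dotProduct_comm xh αh]
end

section
/- Let Q ∈ ℝ^{n×d} have orthonormal columns (QᵀQ = I_d), let f : ℝⁿ → ℝ, x⁰ ∈ ℝⁿ, Ŝ = [ŝ¹ ⋯ ŝ^p] ∈ ℝ^{d×p}, and S = Q Ŝ. Define f̂ : ℝᵈ → ℝ by f̂(x̂) = f(x⁰ + Q x̂). If P ∈ ℝ^{n×p} is a Moore–Penrose pseudoinverse of Sᵀ and P̂ ∈ ℝ^{d×p} is a Moore–Penrose pseudoinverse of Ŝᵀ, then the generalized simplex gradients satisfy P δ_f(x⁰; S) = Q (P̂ δ_f̂(0; Ŝ)), i.e., ∇ₛf(x⁰; S) = Q ∇ₛf̂(0; Ŝ). -/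
open Matrix

/-- The Moore–Penrose pseudoinverse is unique. -/
theorem IsMPInv.unique {a b : ℕ} {A : Matrix (Fin a) (Fin b) ℝ} {X Y : Matrix (Fin b) (Fin a) ℝ}
    (hX : IsMPInv A X) (hY : IsMPInv A Y) : X = Y := by
  obtain ⟨hX1, hX2, hX3, hX4⟩ := hX
  obtain ⟨hY1, hY2, hY3, hY4⟩ := hY
  have hl : A * X = A * Y := by
    calc A * X = (A * Y) * (A * X) := by rw [← Matrix.mul_assoc, hY1]
      _ = ((A * X) * (A * Y))ᵀ := by rw [transpose_mul, hX3, hY3]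
      _ = A * Y := by rw [← Matrix.mul_assoc, hX1, hY3]
  have hr : X * A = Y * A := by
    calc X * A = (X * A) * (Y * A) := by rw [Matrix.mul_assoc, ← Matrix.mul_assoc A, hY1]
      _ = ((Y * A) * (X * A))ᵀ := by rw [transpose_mul, hX4, hY4]
      _ = Y * A := by rw [Matrix.mul_assoc, ← Matrix.mul_assoc A, hX1, hY4]
  calc X = X * A * X := hX2.symm
    _ = Y * (A * X) := by rw [hr, Matrix.mul_assoc]
    _ = Y := by rw [hl, ← Matrix.mul_assoc, hY2]

/-- Left multiplication by a matrix with orthonormal columns carries a pseudoinverse of `Bᵀ` to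
a pseudoinverse of `(Q * B)ᵀ`. -/
theorem IsMPInv.orthonormal_mul {n d p : ℕ} {Q : Matrix (Fin n) (Fin d) ℝ} (hQ : Qᵀ * Q = 1)
    {B X : Matrix (Fin d) (Fin p) ℝ} (hX : IsMPInv Bᵀ X) : IsMPInv (Q * B)ᵀ (Q * X) := by
  obtain ⟨h1, h2, h3, h4⟩ := hX
  have hl : (Q * B)ᵀ * (Q * X) = Bᵀ * X := by
    rw [transpose_mul, Matrix.mul_assoc, ← Matrix.mul_assoc Qᵀ, hQ, Matrix.one_mul]
  have hr : (Q * X) * (Q * B)ᵀ = Q * (X * Bᵀ) * Qᵀ := by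
    simp only [transpose_mul, Matrix.mul_assoc]
  refine ⟨?_, ?_, ?_, ?_⟩
  · rw [hl, transpose_mul, ← Matrix.mul_assoc, h1]
  · rw [Matrix.mul_assoc, hl, Matrix.mul_assoc, ← Matrix.mul_assoc X, h2]
  · rw [hl, h3]
  · rw [hr, transpose_mul, transpose_mul, h4, transpose_transpose, ← Matrix.mul_assoc Q]

/-- With `S = Q Ŝ` and `f̂(x̂) = f(x⁰ + Q x̂)`, the generalized simplex
gradients satisfy `∇ₛf(x⁰; S) = Q ∇ₛf̂(0; Ŝ)`, where the pseudoinverses of `Sᵀ` and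
`Ŝᵀ` are `P` and `P̂` respectively. -/
theorem stmt_14 {n d p : ℕ}
    (Q : Matrix (Fin n) (Fin d) ℝ) (hQ : Qᵀ * Q = 1)
    (f : (Fin n → ℝ) → ℝ) (x0 : Fin n → ℝ)
    (fh : (Fin d → ℝ) → ℝ) (hfh : ∀ xh, fh xh = f (x0 + Q.mulVec xh))
    (Sh : Matrix (Fin d) (Fin p) ℝ)
    (P : Matrix (Fin n) (Fin p) ℝ) (hP : IsMPInv ((Q * Sh)ᵀ) P)
    (Ph : Matrix (Fin d) (Fin p) ℝ) (hPh : IsMPInv Shᵀ Ph) :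
    P.mulVec (deltaVec f x0 (Q * Sh)) = Q.mulVec (Ph.mulVec (deltaVec fh 0 Sh)) := by
  have hδ : deltaVec f x0 (Q * Sh) = deltaVec fh 0 Sh := by
    funext i
    simp only [deltaVec, hfh, zero_add, mulVec_zero, add_zero]
    rfl
  rw [hP.unique (hPh.orthonormal_mul hQ), hδ, mulVec_mulVec]
end
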